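/- Let Γ ⊂ ℝ³ be a compact set, μ a finite Borel measure on ℝ³ whose support is contained in Γ, m, j : ℝ³ → ℂ³ bounded measurable vector fields, and λ, κ ∈ ℂ. On the open set ℝ³ \ Γ define Φ(x) = ∫ G(x, y; λ) m(y) dμ(y), Ψ(x) = ∫ G(x, y; λ) j(y) dμ(y), and E := curl Φ − κ · curl(curl Ψ). Then E is infinitely differentiable on ℝ³ \ Γ and satisfies curl(curl E) + λ² E = 0 there. -/

import Mathlib

open MeasureTheory Filter Topology

noncomputable section

/-- ℝ³ with the Euclidean norm. -/
abbrev V3 : Type := EuclideanSpace ℝ (Fin 3)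

/-- Partial derivative in the `i`-th coordinate direction of `f : ℝ³ → ℂ`. -/
def pd (i : Fin 3) (f : V3 → ℂ) (x : V3) : ℂ :=
  fderiv ℝ f x (EuclideanSpace.single i 1)

/-- Componentwise Laplacian `Δf = ∂₁²f + ∂₂²f + ∂₃²f`. -/
def lap (f : V3 → ℂ) (x : V3) : ℂ :=
  ∑ i : Fin 3, pd i (fun y => pd i f y) x

/-- Curl of a vector field `u : ℝ³ → ℂ³`, defined cyclically:
`(curl u)ᵢ = ∂_{i+1} u_{i+2} − ∂_{i+2} u_{i+1}`. -/
def curl (u : V3 → Fin 3 → ℂ) (x : V3) : Fin 3 → ℂ :=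
  fun i => pd (i + 1) (fun y => u y (i + 2)) x - pd (i + 2) (fun y => u y (i + 1)) x

/-- The Yukawa kernel `G(x, y; λ) = e^{−λ‖x−y‖}/(4π‖x−y‖)`. -/
def G (lam : ℂ) (x y : V3) : ℂ :=
  Complex.exp (-lam * (‖x - y‖ : ℝ)) / ((4 * Real.pi * ‖x - y‖ : ℝ) : ℂ)


section PartialDerivatives

theorem contDiff_pd {f : V3 → ℂ} (hf : ContDiff ℝ (⊤ : ℕ∞) f) (i : Fin 3) :
    ContDiff ℝ (⊤ : ℕ∞) (pd i f) :=
  (hf.fderiv_right (m := (⊤ : ℕ∞)) (by simp)).clm_apply contDiff_const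

theorem pd_sub {f g : V3 → ℂ} (hf : ContDiff ℝ (⊤ : ℕ∞) f) (hg : ContDiff ℝ (⊤ : ℕ∞) g)
    (i : Fin 3) (x : V3) : pd i (fun y => f y - g y) x = pd i f x - pd i g x := by
  unfold pd
  rw [fderiv_fun_sub (hf.differentiable (by simp) x) (hg.differentiable (by simp) x)]
  rfl

theorem pd_add {f g : V3 → ℂ} (hf : ContDiff ℝ (⊤ : ℕ∞) f) (hg : ContDiff ℝ (⊤ : ℕ∞) g)
    (i : Fin 3) (x : V3) : pd i (fun y => f y + g y) x = pd i f x + pd i g x := by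
  unfold pd
  rw [fderiv_fun_add (hf.differentiable (by simp) x) (hg.differentiable (by simp) x)]
  rfl

theorem pd_const_mul {f : V3 → ℂ} (hf : ContDiff ℝ (⊤ : ℕ∞) f) (c : ℂ) (i : Fin 3) (x : V3) :
    pd i (fun y => c * f y) x = c * pd i f x := by
  unfold pd
  rw [fderiv_const_mul (hf.differentiable (by simp) x)]
  rfl

theorem pd_comm {f : V3 → ℂ} (hf : ContDiff ℝ (⊤ : ℕ∞) f) (i k : Fin 3) (x : V3) :
    pd i (pd k f) x = pd k (pd i f) x := by
  have hd : DifferentiableAt ℝ (fderiv ℝ f) x :=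
    (hf.fderiv_right (m := (⊤ : ℕ∞)) (by simp)).differentiable (by simp) x
  have key (a b : Fin 3) : pd a (pd b f) x =
      fderiv ℝ (fderiv ℝ f) x (EuclideanSpace.single a 1) (EuclideanSpace.single b 1) := by
    unfold pd
    rw [fderiv_clm_apply hd (differentiableAt_const _)]
    simp
  rw [key, key]
  have hn : (2 : WithTop ℕ∞) ≤ ((⊤ : ℕ∞) : WithTop ℕ∞) := by
    exact WithTop.coe_le_coe.2 (le_top : (2 : ℕ∞) ≤ ⊤)
  exact hf.contDiffAt.isSymmSndFDerivAt (by simpa using hn) _ _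

theorem pd_congr {f g : V3 → ℂ} {x : V3} (h : f =ᶠ[𝓝 x] g) (i : Fin 3) :
    pd i f =ᶠ[𝓝 x] pd i g :=
  (h.fderiv (𝕜 := ℝ)).mono fun y hy => by simp only [pd, hy]

theorem lap_congr {f g : V3 → ℂ} {x : V3} (h : f =ᶠ[𝓝 x] g) : lap f x = lap g x :=
  Finset.sum_congr rfl fun i _ => (pd_congr (pd_congr h i) i).eq_of_nhds

theorem curl_congr {u v : V3 → Fin 3 → ℂ} {x : V3} (h : u =ᶠ[𝓝 x] v) :
    curl u =ᶠ[𝓝 x] curl v := by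
  have hk (k : Fin 3) : (fun y => u y k) =ᶠ[𝓝 x] fun y => v y k :=
    h.mono fun y hy => congrFun hy k
  have hp (a k : Fin 3) := pd_congr (hk k) a
  filter_upwards [eventually_all.2 fun a => eventually_all.2 fun k => hp a k] with y hy
  funext i
  simp only [curl, hy]

end PartialDerivatives

section VectorCalculus

theorem contDiff_curl {u : V3 → Fin 3 → ℂ} (hu : ∀ i, ContDiff ℝ (⊤ : ℕ∞) fun x => u x i)
    (i : Fin 3) : ContDiff ℝ (⊤ : ℕ∞) fun x => curl u x i :=
  (contDiff_pd (hu _) _).sub (contDiff_pd (hu _) _)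

theorem curl_sub_const_mul {u v : V3 → Fin 3 → ℂ}
    (hu : ∀ i, ContDiff ℝ (⊤ : ℕ∞) fun x => u x i)
    (hv : ∀ i, ContDiff ℝ (⊤ : ℕ∞) fun x => v x i) (c : ℂ) (x : V3) (i : Fin 3) :
    curl (fun y k => u y k - c * v y k) x i = curl u x i - c * curl v x i := by
  simp only [curl]
  rw [pd_sub (hu _) (contDiff_const.mul (hv _)), pd_sub (hu _) (contDiff_const.mul (hv _)),
    pd_const_mul (hv _), pd_const_mul (hv _)]
  ring

/-- `Δ (curl u) = curl (Δ u)`. -/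
theorem lap_curl {u : V3 → Fin 3 → ℂ} (hu : ∀ i, ContDiff ℝ (⊤ : ℕ∞) fun x => u x i)
    (x : V3) (i : Fin 3) :
    lap (fun y => curl u y i) x = curl (fun y k => lap (fun z => u z k) y) x i := by
  have h2 (a k : Fin 3) := contDiff_pd (hu k) a
  have h3 (a b k : Fin 3) := contDiff_pd (h2 b k) a
  have hl (a k : Fin 3) : pd a (fun y => lap (fun z => u z k) y) x =
      ∑ b, pd b (pd b (pd a fun z => u z k)) x := by
    simp only [lap, Fin.sum_univ_three]
    rw [pd_add ((h3 _ _ _).add (h3 _ _ _)) (h3 _ _ _), pd_add (h3 _ _ _) (h3 _ _ _)]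
    have hc (b : Fin 3) : pd a (pd b (pd b fun z => u z k)) x =
        pd b (pd b (pd a fun z => u z k)) x := by
      rw [pd_comm (h2 _ _)]
      congr 1
      funext y
      exact pd_comm (hu _) _ _ _
    rw [← hc, ← hc, ← hc]
  simp only [curl, hl]
  rw [lap, ← Finset.sum_sub_distrib]
  refine Finset.sum_congr rfl fun b _ => ?_
  rw [← pd_sub (h3 _ _ _) (h3 _ _ _)]
  congr 1
  funext y
  exact pd_sub (h2 _ _) (h2 _ _) _ _

/-- `curl curl u = grad div u - Δ u`. -/
theorem curl_curl {u : V3 → Fin 3 → ℂ} (hu : ∀ i, ContDiff ℝ (⊤ : ℕ∞) fun x => u x i)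
    (x : V3) (i : Fin 3) :
    curl (curl u) x i =
      pd i (fun y => ∑ k, pd k (fun z => u z k) y) x - lap (fun y => u y i) x := by
  have h2 (a k : Fin 3) := contDiff_pd (hu k) a
  have hs (a b k c l : Fin 3) :
      pd a (fun y => pd b (fun z => u z k) y - pd c (fun z => u z l) y) x =
      pd a (pd b fun z => u z k) x - pd a (pd c fun z => u z l) x :=
    pd_sub (h2 _ _) (h2 _ _) _ _
  have hdiv : pd i (fun y => ∑ k, pd k (fun z => u z k) y) x =
      ∑ k, pd k (pd i fun z => u z k) x := by
    simp only [Fin.sum_univ_three]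
    rw [pd_add ((h2 _ _).add (h2 _ _)) (h2 _ _), pd_add (h2 _ _) (h2 _ _),
      pd_comm (hu 0), pd_comm (hu 1), pd_comm (hu 2)]
  rw [hdiv]
  simp only [curl, hs, lap, Fin.sum_univ_three]
  fin_cases i <;> simp <;> ring

/-- `div curl u = 0`. -/
theorem div_curl {u : V3 → Fin 3 → ℂ} (hu : ∀ i, ContDiff ℝ (⊤ : ℕ∞) fun x => u x i)
    (x : V3) : ∑ k, pd k (fun z => curl u z k) x = 0 := by
  have h2 (a k : Fin 3) := contDiff_pd (hu k) a
  have hs (a b k c l : Fin 3) :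
      pd a (fun y => pd b (fun z => u z k) y - pd c (fun z => u z l) y) x =
      pd a (pd b fun z => u z k) x - pd a (pd c fun z => u z l) x :=
    pd_sub (h2 _ _) (h2 _ _) _ _
  simp only [curl, hs, Fin.sum_univ_three, Fin.isValue, Fin.reduceAdd, zero_add]
  rw [pd_comm (hu 2) 0 1, pd_comm (hu 1) 0 2, pd_comm (hu 0) 1 2]
  ring

/-- `curl curl curl u = - curl (Δ u)`. -/
theorem curl_curl_curl {u : V3 → Fin 3 → ℂ} (hu : ∀ i, ContDiff ℝ (⊤ : ℕ∞) fun x => u x i)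
    (x : V3) (i : Fin 3) :
    curl (curl (curl u)) x i = -curl (fun y k => lap (fun z => u z k) y) x i := by
  rw [curl_curl (contDiff_curl hu), lap_curl hu, funext (div_curl hu)]
  simp [pd]

/-- If `u` is a smooth solution of `Δ u = c u` near `x`, then `curl curl curl u = -c curl u`
at `x`. -/
theorem curl_curl_curl_of_lap_eq {u : V3 → Fin 3 → ℂ}
    (hu : ∀ i, ContDiff ℝ (⊤ : ℕ∞) fun x => u x i) {c : ℂ} {x : V3}
    (hc : ∀ᶠ y in 𝓝 x, ∀ i, lap (fun z => u z i) y = c * u y i) (i : Fin 3) :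
    curl (curl (curl u)) x i = -(c * curl u x i) := by
  have h : (fun y k => lap (fun z => u z k) y) =ᶠ[𝓝 x] fun y k => c * u y k :=
    hc.mono fun y hy => funext hy
  rw [curl_curl_curl hu, (curl_congr h).eq_of_nhds]
  simp only [curl]
  rw [pd_const_mul (hu _), pd_const_mul (hu _)]
  ring

theorem lap_sub_const_mul {f g : V3 → ℂ} (hf : ContDiff ℝ (⊤ : ℕ∞) f)
    (hg : ContDiff ℝ (⊤ : ℕ∞) g) (c : ℂ) (x : V3) :
    lap (fun y => f y - c * g y) x = lap f x - c * lap g x := by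
  have h (i : Fin 3) : pd i (fun y => f y - c * g y) = fun y => pd i f y - c * pd i g y := by
    funext y
    rw [pd_sub hf (contDiff_const.mul hg), pd_const_mul hg]
  simp only [lap, h, Finset.mul_sum, ← Finset.sum_sub_distrib]
  refine Finset.sum_congr rfl fun i _ => ?_
  rw [pd_sub (contDiff_pd hf i) (contDiff_const.mul (contDiff_pd hg i)),
    pd_const_mul (contDiff_pd hg i)]

end VectorCalculus

section Potential

variable {μ : Measure V3} {f : V3 → ℂ} {h : V3 → ℂ}

theorem contDiff_potential (hf : Integrable f μ) (hc : HasCompactSupport h)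
    (hh : ContDiff ℝ (⊤ : ℕ∞) h) :
    ContDiff ℝ (⊤ : ℕ∞) fun x => ∫ y, h (x - y) * f y ∂μ := by
  have := hc.contDiff_convolution_right (ContinuousLinearMap.mul ℝ ℂ)
    hf.locallyIntegrable hh
  convert this using 2 with x
  simp [convolution, mul_comm]

theorem pd_potential (hf : Integrable f μ) (hc : HasCompactSupport h)
    (hh : ContDiff ℝ (⊤ : ℕ∞) h) (i : Fin 3) (x : V3) :
    pd i (fun x => ∫ y, h (x - y) * f y ∂μ) x = ∫ y, pd i h (x - y) * f y ∂μ := by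
  have hd : Continuous (fderiv ℝ h) := hh.continuous_fderiv (by simp)
  obtain ⟨M, hM⟩ := (hc.fderiv ℝ).exists_bound_of_continuous hd
  obtain ⟨B, hB⟩ := hc.exists_bound_of_continuous hh.continuous
  have hsub (x : V3) : Continuous fun y : V3 => x - y := continuous_const.sub continuous_id
  have hint (x : V3) : Integrable (fun y => h (x - y) * f y) μ :=
    hf.bdd_mul (hh.continuous.comp (hsub x)).aestronglyMeasurable (ae_of_all _ fun y => hB _)
  have hint' (x : V3) : Integrable (fun y => f y • fderiv ℝ h (x - y)) μ :=
    hf.smul_bdd M (hd.comp (hsub x)).aestronglyMeasurable (ae_of_all _ fun y => hM _)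
  have key := hasFDerivAt_integral_of_dominated_of_fderiv_le (𝕜 := ℝ) (μ := μ)
    (F := fun x y => h (x - y) * f y) (F' := fun x y => f y • fderiv ℝ h (x - y))
    (x₀ := x) (bound := fun y => ‖f y‖ * M) (s := Set.univ) Filter.univ_mem
    (Eventually.of_forall fun x => (hint x).aestronglyMeasurable) (hint x)
    (hint' x).aestronglyMeasurable
    (ae_of_all _ fun y z _ => by
      rw [norm_smul]; exact mul_le_mul_of_nonneg_left (hM _) (norm_nonneg _))
    (hf.norm.mul_const M)
    (ae_of_all _ fun y z _ => by
      have h1 : HasFDerivAt h (fderiv ℝ h (z - y)) (z - y) :=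
        (hh.differentiable (by simp) _).hasFDerivAt
      exact (h1.comp z ((hasFDerivAt_id z).sub_const y)).mul_const (f y))
  rw [pd, key.fderiv, ContinuousLinearMap.integral_apply (hint' x)]
  simp [pd, mul_comm]

theorem lap_potential (hf : Integrable f μ) (hc : HasCompactSupport h)
    (hh : ContDiff ℝ (⊤ : ℕ∞) h) (x : V3) :
    lap (fun x => ∫ y, h (x - y) * f y ∂μ) x = ∫ y, lap h (x - y) * f y ∂μ := by
  have hpc (i : Fin 3) : HasCompactSupport (pd i h) := hc.fderiv_apply ℝ _
  have hps (i : Fin 3) := contDiff_pd hh i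
  have hpp (i : Fin 3) : HasCompactSupport (pd i (pd i h)) := (hpc i).fderiv_apply ℝ _
  have hint (i : Fin 3) : Integrable (fun y => pd i (pd i h) (x - y) * f y) μ := by
    have hcont := (contDiff_pd (hps i) i).continuous
    obtain ⟨B, hB⟩ := (hpp i).exists_bound_of_continuous hcont
    exact hf.bdd_mul (hcont.comp (continuous_const.sub continuous_id)).aestronglyMeasurable
      (ae_of_all _ fun y => hB _)
  simp only [lap, Finset.sum_mul]
  rw [integral_finsetSum _ fun i _ => hint i]
  refine Finset.sum_congr rfl fun i _ => ?_
  rw [← pd_potential hf (hpc i) (hps i)]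
  congr 1
  funext z
  exact pd_potential hf hc hh i z

end Potential

section Kernel

theorem G_eq_G_zero (lam : ℂ) (x y : V3) : G lam x y = G lam (x - y) 0 := by
  simp [G]

theorem contDiffAt_G_zero (lam : ℂ) {z : V3} (hz : z ≠ 0) :
    ContDiffAt ℝ (⊤ : ℕ∞) (fun z => G lam z 0) z := by
  have hn : ContDiffAt ℝ (⊤ : ℕ∞) (fun z : V3 => ((‖z‖ : ℝ) : ℂ)) z :=
    Complex.ofRealCLM.contDiff.contDiffAt.comp z (contDiffAt_norm ℝ hz)
  have h0 : ((‖z‖ : ℝ) : ℂ) ≠ 0 := by simpa using hz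
  have hd : ((4 * Real.pi * ‖z‖ : ℝ) : ℂ) ≠ 0 := by
    simpa [Real.pi_ne_zero] using hz
  have hn' : ContDiffAt ℝ (⊤ : ℕ∞) (fun z : V3 => ((4 * Real.pi * ‖z‖ : ℝ) : ℂ)) z :=
    Complex.ofRealCLM.contDiff.contDiffAt.comp z (contDiffAt_const.mul (contDiffAt_norm ℝ hz))
  simp only [G, sub_zero, div_eq_mul_inv]
  exact (contDiffAt_const.mul hn).cexp.mul (hn'.inv hd)

theorem hasFDerivAt_radial {φ : ℝ → ℂ} {φ' : ℂ} {z : V3} (hz : z ≠ 0)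
    (hφ : HasDerivAt φ φ' ‖z‖) :
    HasFDerivAt (fun z : V3 => φ ‖z‖) (((‖z‖⁻¹ : ℝ) • innerSL ℝ z).smulRight φ') z := by
  have hn : HasFDerivAt (fun z : V3 => ‖z‖) ((‖z‖⁻¹ : ℝ) • innerSL ℝ z) z := by
    have h := (hasStrictFDerivAt_norm_sq z).hasFDerivAt.sqrt (by simpa using hz)
    simp only [Real.sqrt_sq (norm_nonneg _)] at h
    refine h.congr_fderiv ?_
    ext w
    simp
    field_simp
  refine (hφ.hasFDerivAt.comp z hn).congr_fderiv ?_
  ext w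
  simp [mul_assoc]

theorem pd_radial {φ : ℝ → ℂ} {φ' : ℂ} {z : V3} (hz : z ≠ 0)
    (hφ : HasDerivAt φ (‖z‖ * φ') ‖z‖) (i : Fin 3) :
    pd i (fun z => φ ‖z‖) z = φ' * (z i : ℝ) := by
  have h0 : ((‖z‖ : ℝ) : ℂ) ≠ 0 := by simpa using hz
  rw [pd, (hasFDerivAt_radial hz hφ).fderiv]
  simp [EuclideanSpace.inner_single_right]
  field_simp

theorem pd_radial_mul_coord {φ : ℝ → ℂ} {φ' : ℂ} {z : V3} (hz : z ≠ 0)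
    (hφ : HasDerivAt φ (‖z‖ * φ') ‖z‖) (i : Fin 3) :
    pd i (fun z => φ ‖z‖ * (z i : ℝ)) z = φ' * (z i : ℝ) ^ 2 + φ ‖z‖ := by
  have hc : HasFDerivAt (fun z : V3 => ((z i : ℝ) : ℂ))
      (Complex.ofRealCLM.comp (EuclideanSpace.proj i : V3 →L[ℝ] ℝ)) z :=
    (Complex.ofRealCLM.comp (EuclideanSpace.proj i : V3 →L[ℝ] ℝ)).hasFDerivAt
  have h1 := pd_radial hz hφ i
  have h2 := hasFDerivAt_radial hz hφ
  rw [pd, h2.fderiv] at h1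
  have h3 := h2.fun_mul hc
  rw [pd, h3.fderiv]
  simp only [add_apply, smul_apply, h1]
  simp
  ring

theorem lap_G_zero (lam : ℂ) {z : V3} (hz : z ≠ 0) :
    lap (fun z => G lam z 0) z = lam ^ 2 * G lam z 0 := by
  have hexp (r : ℝ) : HasDerivAt (fun r : ℝ => Complex.exp (-lam * (r : ℝ)))
      (Complex.exp (-lam * r) * (-lam * 1)) r :=
    ((hasDerivAt_id r).ofReal_comp.const_mul (-lam)).cexp
  have hpi : (Real.pi : ℂ) ≠ 0 := by simp [Real.pi_ne_zero]
  let b : ℝ → ℂ := fun r =>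
    -((lam * (r : ℝ) + 1) * Complex.exp (-lam * (r : ℝ))) / (4 * Real.pi * (r : ℝ) ^ 3)
  have hφ (r : ℝ) (hr : r ≠ 0) : HasDerivAt
      (fun r : ℝ => Complex.exp (-lam * (r : ℝ)) / ((4 * Real.pi * r : ℝ) : ℂ))
      (r * b r) r := by
    have hr' : (r : ℂ) ≠ 0 := by simpa using hr
    have hden : HasDerivAt (fun r : ℝ => ((4 * Real.pi * r : ℝ) : ℂ))
        ((4 * Real.pi * 1 : ℝ) : ℂ) r := ((hasDerivAt_id r).const_mul _).ofReal_comp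
    refine ((hexp r).div hden (by simp [hr, Real.pi_ne_zero])).congr_deriv ?_
    simp only [b]
    push_cast
    field_simp
    ring
  have hb (r : ℝ) (hr : r ≠ 0) : HasDerivAt b (r * (Complex.exp (-lam * r) *
      (lam ^ 2 * r ^ 2 + 3 * lam * r + 3) / (4 * Real.pi * (r : ℂ) ^ 5))) r := by
    have hr' : (r : ℂ) ≠ 0 := by simpa using hr
    have hid : HasDerivAt (fun r : ℝ => (r : ℂ)) 1 r := (hasDerivAt_id r).ofReal_comp
    have hnum := (((hid.const_mul lam).add_const 1).mul (hexp r)).neg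
    have hden := (hid.pow 3).const_mul (4 * Real.pi : ℂ)
    refine (hnum.div hden
      (mul_ne_zero (mul_ne_zero (by simp) hpi) (pow_ne_zero _ hr'))).congr_deriv ?_
    simp
    field_simp
    ring
  have hpd (i : Fin 3) :
      pd i (fun z => G lam z 0) =ᶠ[𝓝 z] fun z => b ‖z‖ * (z i : ℝ) := by
    filter_upwards [isOpen_ne.mem_nhds hz] with w hw
    simp only [G, sub_zero]
    exact pd_radial hw (hφ _ (norm_ne_zero_iff.2 hw)) i
  have h0 : ‖z‖ ≠ 0 := norm_ne_zero_iff.2 hz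
  have hcoord (i : Fin 3) := (pd_congr (hpd i) i).eq_of_nhds.trans
    (pd_radial_mul_coord hz (hb _ h0) i)
  have hnorm : ((z 0 : ℝ) : ℂ) ^ 2 + ((z 1 : ℝ) : ℂ) ^ 2 + ((z 2 : ℝ) : ℂ) ^ 2 =
      ((‖z‖ : ℝ) : ℂ) ^ 2 := by
    have h := EuclideanSpace.real_norm_sq_eq z
    rw [Fin.sum_univ_three] at h
    exact_mod_cast h.symm
  have h0' : ((‖z‖ : ℝ) : ℂ) ≠ 0 := by simpa using hz
  have hsum : lap (fun z => G lam z 0) z = Complex.exp (-lam * ‖z‖) *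
      (lam ^ 2 * ‖z‖ ^ 2 + 3 * lam * ‖z‖ + 3) / (4 * Real.pi * (‖z‖ : ℂ) ^ 5) *
      ((z 0 : ℝ) ^ 2 + (z 1 : ℝ) ^ 2 + (z 2 : ℝ) ^ 2) + 3 * b ‖z‖ := by
    rw [lap, Fin.sum_univ_three]
    refine (congrArg₂ _ (congrArg₂ _ (hcoord 0) (hcoord 1)) (hcoord 2)).trans ?_
    ring
  rw [hsum, hnorm]
  simp only [G, b, sub_zero]
  push_cast
  field_simp
  ring

/-- Away from a compact set, the kernel can be replaced by a smooth compactly supported function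
of the difference variable. -/
theorem exists_smooth_kernel (lam : ℂ) {Γ : Set V3} (hΓ : IsCompact Γ) {x₀ : V3}
    (hx₀ : x₀ ∉ Γ) :
    ∃ h : V3 → ℂ, ContDiff ℝ (⊤ : ℕ∞) h ∧ HasCompactSupport h ∧
      ∀ᶠ x in 𝓝 x₀, ∀ y ∈ Γ, x - y ≠ 0 ∧ h =ᶠ[𝓝 (x - y)] fun z => G lam z 0 := by
  obtain ⟨ε, hε, hball⟩ := Metric.isOpen_iff.1 hΓ.isClosed.isOpen_compl x₀ hx₀
  obtain ⟨R, hR, hΓR⟩ := hΓ.isBounded.subset_ball_lt 0 x₀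
  let inner : ContDiffBump (0 : V3) := ⟨ε / 4, ε / 2, by positivity, by linarith⟩
  let outer : ContDiffBump (0 : V3) := ⟨R + ε, R + ε + 1, by positivity, by linarith⟩
  let χ : V3 → ℝ := fun z => outer z * (1 - inner z)
  have hχ : ContDiff ℝ (⊤ : ℕ∞) χ := outer.contDiff.mul (contDiff_const.sub inner.contDiff)
  refine ⟨fun z => (χ z : ℂ) * G lam z 0, ?_, ?_, ?_⟩
  · rw [contDiff_iff_contDiffAt]
    intro z
    rcases eq_or_ne z 0 with rfl | hz
    · refine (contDiffAt_const (c := (0 : ℂ))).congr_of_eventuallyEq ?_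
      filter_upwards [inner.eventuallyEq_one] with w hw
      simp [χ, hw]
    · exact (Complex.ofRealCLM.contDiff.comp hχ).contDiffAt.mul (contDiffAt_G_zero lam hz)
  · refine outer.hasCompactSupport.mono fun z hz => ?_
    contrapose! hz
    simp [χ, Function.notMem_support.1 hz]
  · filter_upwards [Metric.ball_mem_nhds x₀ (half_pos hε)] with x hx y hy
    have hx' : ‖x - x₀‖ < ε / 2 := by simpa [dist_eq_norm] using hx
    have hy₁ : ε ≤ ‖x₀ - y‖ := by
      by_contra! hlt
      exact hball (by simpa [dist_eq_norm, norm_sub_rev] using hlt) hy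
    have hy₂ : ‖y - x₀‖ < R := by simpa [dist_eq_norm] using hΓR hy
    have h₁ : ε / 2 < ‖x - y‖ := by
      have := norm_sub_le_norm_sub_add_norm_sub x₀ x y
      rw [norm_sub_rev x₀ x] at this
      linarith
    have h₂ : ‖x - y‖ < R + ε := by
      have := norm_sub_le_norm_sub_add_norm_sub x x₀ y
      rw [norm_sub_rev x₀ y] at this
      linarith
    refine ⟨norm_pos_iff.1 (by linarith), ?_⟩
    filter_upwards [(isOpen_lt continuous_const continuous_norm).mem_nhds h₁,
      (isOpen_lt continuous_norm continuous_const).mem_nhds h₂] with z hz₁ hz₂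
    have hi : inner z = 0 := inner.zero_of_le_dist (by simpa using hz₁.le)
    have ho : outer z = 1 := outer.one_of_mem_closedBall (by simpa using hz₂.le)
    simp [χ, hi, ho]

end Kernel

/-- Near a point off the compact set carrying `μ`, the Yukawa single layer potentials of all
integrable densities coincide with smooth solutions of the Helmholtz equation. -/
theorem exists_smooth_layer_potential {Γ : Set V3} (hΓ : IsCompact Γ) {μ : Measure V3}
    (hμ : μ Γᶜ = 0) {m : V3 → Fin 3 → ℂ} (hm : ∀ i, Integrable (fun y => m y i) μ) (lam : ℂ)
    {x₀ : V3} (hx₀ : x₀ ∉ Γ) :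
    ∃ u : V3 → Fin 3 → ℂ, (∀ i, ContDiff ℝ (⊤ : ℕ∞) fun x => u x i) ∧
      ((fun x i => ∫ y, G lam x y * m y i ∂μ) =ᶠ[𝓝 x₀] u) ∧
      ∀ᶠ x in 𝓝 x₀, ∀ i, lap (fun z => u z i) x = lam ^ 2 * u x i := by
  obtain ⟨h, hh, hc, hG⟩ := exists_smooth_kernel lam hΓ hx₀
  have hae : ∀ᵐ y ∂μ, y ∈ Γ := hμ
  refine ⟨fun x i => ∫ y, h (x - y) * m y i ∂μ, fun i => contDiff_potential (hm i) hc hh, ?_, ?_⟩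
  · filter_upwards [hG] with x hx
    funext i
    refine integral_congr_ae ?_
    filter_upwards [hae] with y hy
    rw [G_eq_G_zero, (hx y hy).2.eq_of_nhds]
  · filter_upwards [hG] with x hx i
    rw [lap_potential (hm i) hc hh, ← integral_const_mul]
    refine integral_congr_ae ?_
    filter_upwards [hae] with y hy
    obtain ⟨hne, heq⟩ := hx y hy
    rw [lap_congr heq, lap_G_zero lam hne, heq.eq_of_nhds, mul_assoc]

/-- the electromagnetic layer-potential ansatz
`E = curl Φ − κ curl (curl Ψ)` built from Yukawa single layer potentials
`Φ(x) = ∫ G(x,y;λ) m(y) dμ(y)` and `Ψ(x) = ∫ G(x,y;λ) j(y) dμ(y)` is smooth on `ℝ³ \ Γ`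
and satisfies `curl (curl E) + λ² E = 0` there. -/
theorem layer_potential_ansatz_solves (Γ : Set V3) (hΓ : IsCompact Γ)
    (μ : Measure V3) [IsFiniteMeasure μ] (hμ : μ Γᶜ = 0)
    (m j : V3 → Fin 3 → ℂ) (hm : Measurable m) (hj : Measurable j)
    (C : ℝ) (hmb : ∀ y, ‖m y‖ ≤ C) (hjb : ∀ y, ‖j y‖ ≤ C)
    (lam κ : ℂ)
    (Φ Ψ E : V3 → Fin 3 → ℂ)
    (hΦ : ∀ x i, Φ x i = ∫ y, G lam x y * m y i ∂μ)
    (hΨ : ∀ x i, Ψ x i = ∫ y, G lam x y * j y i ∂μ)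
    (hE : ∀ x i, E x i = curl Φ x i - κ * curl (curl Ψ) x i) :
    (∀ i : Fin 3, ContDiffOn ℝ (⊤ : ℕ∞) (fun x => E x i) Γᶜ) ∧
    ∀ x ∈ Γᶜ, ∀ i : Fin 3, curl (curl E) x i + lam ^ 2 * E x i = 0 := by
  have hint {f : V3 → Fin 3 → ℂ} (hf : Measurable f) (hfb : ∀ y, ‖f y‖ ≤ C) (i : Fin 3) :
      Integrable (fun y => f y i) μ :=
    .of_bound ((measurable_pi_apply i).comp hf).aestronglyMeasurable C
      (ae_of_all _ fun y => (norm_le_pi_norm _ i).trans (hfb y))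
  have hloc : ∀ x ∈ Γᶜ, ∃ A : V3 → Fin 3 → ℂ, (∀ i, ContDiff ℝ (⊤ : ℕ∞) fun y => A y i) ∧
      E =ᶠ[𝓝 x] curl A ∧ ∀ᶠ y in 𝓝 x, ∀ i, lap (fun z => A z i) y = lam ^ 2 * A y i := by
    intro x hx
    obtain ⟨u, hu, hΦu, hul⟩ := exists_smooth_layer_potential hΓ hμ (hint hm hmb) lam hx
    obtain ⟨v, hv, hΨv, hvl⟩ := exists_smooth_layer_potential hΓ hμ (hint hj hjb) lam hx
    rw [← show Φ = _ from funext fun x => funext (hΦ x)] at hΦu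
    rw [← show Ψ = _ from funext fun x => funext (hΨ x)] at hΨv
    have hcv := contDiff_curl hv
    refine ⟨fun y k => u y k - κ * curl v y k,
      fun i => (hu i).sub (contDiff_const.mul (hcv i)), ?_, ?_⟩
    · filter_upwards [curl_congr hΦu, curl_congr (curl_congr hΨv)] with y h₁ h₂
      funext i
      rw [hE, curl_sub_const_mul hu hcv, h₁, h₂]
    · filter_upwards [hul, hvl.eventually_nhds] with y h₁ h₂ i
      have h₃ : (fun y k => lap (fun z => v z k) y) =ᶠ[𝓝 y] fun y k => lam ^ 2 * v y k :=
        h₂.mono fun y hy => funext hy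
      rw [lap_sub_const_mul (hu i) (hcv i), h₁, lap_curl hv, (curl_congr h₃).eq_of_nhds]
      simp only [curl]
      rw [pd_const_mul (hv _), pd_const_mul (hv _)]
      ring
  refine ⟨fun i x hx => ?_, fun x hx i => ?_⟩
  · obtain ⟨A, hA, hEA, -⟩ := hloc x hx
    exact ((contDiff_curl hA i).contDiffAt.congr_of_eventuallyEq
      (hEA.mono fun y hy => congrFun hy i)).contDiffWithinAt
  · obtain ⟨A, hA, hEA, hAl⟩ := hloc x hx
    rw [(curl_congr (curl_congr hEA)).eq_of_nhds, hEA.eq_of_nhds,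
      curl_curl_curl_of_lap_eq hA hAl]
    ring
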